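/- Suppose that for every (s,a) ∈ 𝒮 × 𝒜 the map θ ↦ ψ(s,a;θ) is differentiable on ℝ^d, and fix H ≥ 1, γ ∈ (0,1) and a reward vector r : 𝒮×𝒜 → ℝ. Then the truncated cumulative reward V_H(θ) = ⟨λ_H(π_θ), r⟩ = Σ_{t=0}^{H−1} γ^t Σ_{τ ∈ (𝒮×𝒜)^H} p(τ|π_θ) r(s_t,a_t) is differentiable in θ, and its gradient equals the expected REINFORCE estimator: ∇_θ V_H(θ) = Σ_{τ ∈ (𝒮×𝒜)^H} p(τ|π_θ) · Σ_{t=0}^{H−1} γ^t · r(s_t,a_t) · Σ_{t'=0}^{t} ∇_θ log π_θ(a_{t'}|s_{t'}). -/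

import Mathlib

open Finset

/-- The soft-max policy `π_θ(a|s) = exp (ψ s a θ) / ∑ a', exp (ψ s a' θ)`. -/
noncomputable def softmaxPolicy {S A : Type*} [Fintype A] {d : ℕ}
    (ψ : S → A → EuclideanSpace ℝ (Fin d) → ℝ)
    (θ : EuclideanSpace ℝ (Fin d)) (s : S) (a : A) : ℝ :=
  Real.exp (ψ s a θ) / ∑ a', Real.exp (ψ s a' θ)

/-- The probability of a length-`H` trajectory `τ` under initial distribution `ξ`,
transition kernel `P` and policy `π`. -/
noncomputable def trajProb {S A : Type*} [Fintype S] [Fintype A] {H : ℕ}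
    (ξ : S → ℝ) (P : S → A → S → ℝ) (π : S → A → ℝ) (τ : Fin H → S × A) : ℝ :=
  ∏ t : Fin H,
    (if (t : ℕ) = 0 then ξ (τ t).1
      else P (τ ⟨(t : ℕ) - 1, lt_of_le_of_lt (Nat.pred_le _) t.isLt⟩).1
             (τ ⟨(t : ℕ) - 1, lt_of_le_of_lt (Nat.pred_le _) t.isLt⟩).2 (τ t).1) *
      π (τ t).1 (τ t).2

section SoftmaxPolicy

variable {S A : Type*} [Fintype A] [Nonempty A] {d : ℕ}
  (ψ : S → A → EuclideanSpace ℝ (Fin d) → ℝ)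

theorem softmaxPolicy_pos (θ : EuclideanSpace ℝ (Fin d)) (s : S) (a : A) :
    0 < softmaxPolicy ψ θ s a :=
  div_pos (Real.exp_pos _) (Finset.sum_pos (fun _ _ => Real.exp_pos _) Finset.univ_nonempty)

theorem sum_softmaxPolicy (θ : EuclideanSpace ℝ (Fin d)) (s : S) :
    ∑ a, softmaxPolicy ψ θ s a = 1 := by
  have h : 0 < ∑ a', Real.exp (ψ s a' θ) :=
    Finset.sum_pos (fun _ _ => Real.exp_pos _) Finset.univ_nonempty
  simp only [softmaxPolicy, ← Finset.sum_div]
  exact div_self h.ne'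

variable {ψ}

theorem differentiable_log_softmaxPolicy (hdiff : ∀ s a, Differentiable ℝ (ψ s a))
    (s : S) (a : A) : Differentiable ℝ fun θ => Real.log (softmaxPolicy ψ θ s a) := by
  have h (θ : EuclideanSpace ℝ (Fin d)) : 0 < ∑ a', Real.exp (ψ s a' θ) :=
    Finset.sum_pos (fun _ _ => Real.exp_pos _) Finset.univ_nonempty
  simp only [softmaxPolicy, Real.log_div (Real.exp_pos _).ne' (h _).ne', Real.log_exp]
  exact (hdiff s a).sub
    ((Differentiable.fun_sum fun a' _ => (hdiff s a').exp).log fun θ => (h θ).ne')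

/-- The score function of the soft-max policy has mean zero. -/
theorem sum_softmaxPolicy_smul_gradient_log (hdiff : ∀ s a, Differentiable ℝ (ψ s a))
    (θ : EuclideanSpace ℝ (Fin d)) (s : S) :
    ∑ a, softmaxPolicy ψ θ s a •
      gradient (fun θ' => Real.log (softmaxPolicy ψ θ' s a)) θ = 0 := by
  have hlog (a : A) : HasFDerivAt (fun θ' => softmaxPolicy ψ θ' s a)
      (softmaxPolicy ψ θ s a • fderiv ℝ (fun θ' => Real.log (softmaxPolicy ψ θ' s a)) θ) θ := by
    have h := ((differentiable_log_softmaxPolicy hdiff s a) θ).hasFDerivAt.exp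
    simpa only [Real.exp_log (softmaxPolicy_pos ψ _ s a)] using h
  have hsum := HasFDerivAt.fun_sum fun a (_ : a ∈ Finset.univ) => hlog a
  simp only [sum_softmaxPolicy] at hsum
  have h0 := hsum.unique (hasFDerivAt_const (1 : ℝ) θ)
  simp only [gradient, ← map_smul, ← map_sum]
  simp [h0]

end SoftmaxPolicy

section Trajectory

variable {S A : Type*} [Fintype S] [Fintype A] {ξ : S → ℝ} {P : S → A → S → ℝ} {π : S → A → ℝ}

/-- Appending a step to a trajectory multiplies its probability by the probability of that step,
for some distribution `q` of the new state. -/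
theorem exists_trajProb_snoc (hξ1 : ∑ s, ξ s = 1) (hP1 : ∀ s a, ∑ s', P s a s' = 1)
    {n : ℕ} (τ : Fin n → S × A) :
    ∃ q : S → ℝ, ∑ s, q s = 1 ∧ ∀ x : S × A,
      trajProb ξ P π (Fin.snoc (α := fun _ => S × A) τ x) =
        trajProb ξ P π τ * (q x.1 * π x.1 x.2) := by
  cases n with
  | zero => exact ⟨ξ, hξ1, fun x => by simp [trajProb, Fin.snoc]⟩
  | succ n =>
    refine ⟨P (τ (Fin.last n)).1 (τ (Fin.last n)).2, hP1 _ _, fun x => ?_⟩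
    rw [trajProb, Fin.prod_univ_castSucc, trajProb]
    congr 1
    · refine Finset.prod_congr rfl fun t _ => ?_
      have ht : (t : ℕ) - 1 < n + 1 := lt_of_le_of_lt (Nat.pred_le _) t.isLt
      have h : Fin.snoc (α := fun _ => S × A) τ x
          ⟨(t : ℕ) - 1, ht.trans (Nat.lt_succ_self _)⟩ = τ ⟨(t : ℕ) - 1, ht⟩ :=
        Fin.snoc_castSucc (α := fun _ => S × A) x τ ⟨(t : ℕ) - 1, ht⟩
      simp only [Fin.snoc_castSucc, Fin.val_castSucc, h]
    · have h : Fin.snoc (α := fun _ => S × A) τ x ⟨n, by omega⟩ = τ (Fin.last n) :=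
        Fin.snoc_castSucc (α := fun _ => S × A) x τ (Fin.last n)
      simp [h]

theorem sum_fin_succ_fun {X M : Type*} [Fintype X] [AddCommMonoid M] {n : ℕ}
    (f : (Fin (n + 1) → X) → M) :
    ∑ τ, f τ = ∑ τ : Fin n → X, ∑ x, f (Fin.snoc (α := fun _ => X) τ x) := by
  rw [← (Fin.snocEquiv fun _ : Fin (n + 1) => X).sum_comp, Fintype.sum_prod_type_right]
  rfl

/-- A function of the past is uncorrelated with any function of the current step whose
conditional mean given the state vanishes. -/
theorem sum_trajProb_mul_smul_eq_zero {E : Type*} [AddCommGroup E] [Module ℝ E]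
    (hξ1 : ∑ s, ξ s = 1) (hP1 : ∀ s a, ∑ s', P s a s' = 1) (hπ : ∀ s, ∑ a, π s a = 1)
    {g : S × A → E} (hg : ∀ s, ∑ a, π s a • g (s, a) = 0) {n : ℕ} (t : Fin n)
    {F : (Fin n → S × A) → ℝ} (hF : ∀ τ τ', (∀ k < t, τ k = τ' k) → F τ = F τ') :
    ∑ τ, (trajProb ξ P π τ * F τ) • g (τ t) = 0 := by
  induction n with
  | zero => exact t.elim0
  | succ n ih =>
    rw [sum_fin_succ_fun]
    induction t using Fin.lastCases with
    | last =>
      refine Finset.sum_eq_zero fun τ _ => ?_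
      obtain ⟨q, -, hq⟩ := exists_trajProb_snoc (π := π) hξ1 hP1 τ
      rw [Fintype.sum_prod_type]
      refine Finset.sum_eq_zero fun s _ => ?_
      obtain hA | ⟨⟨a₀⟩⟩ := isEmpty_or_nonempty A
      · simp
      have hFc (a : A) : F (Fin.snoc (α := fun _ => S × A) τ (s, a)) =
          F (Fin.snoc (α := fun _ => S × A) τ (s, a₀)) := by
        refine hF _ _ fun k hk => ?_
        obtain ⟨j, rfl⟩ := Fin.exists_castSucc_eq.mpr hk.ne
        simp
      calc _ = ∑ a, (trajProb ξ P π τ * q s * F (Fin.snoc (α := fun _ => S × A) τ (s, a₀))) •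
            π s a • g (s, a) := by
            refine Finset.sum_congr rfl fun a _ => ?_
            rw [hq, hFc, Fin.snoc_last, smul_smul]
            congr 1
            ring
        _ = 0 := by rw [← Finset.smul_sum, hg, smul_zero]
    | cast t =>
      obtain hX | ⟨⟨x₀⟩⟩ := isEmpty_or_nonempty (S × A)
      · simp
      rw [← ih t (F := fun τ => F (Fin.snoc (α := fun _ => S × A) τ x₀)) ?_]
      · refine Finset.sum_congr rfl fun τ _ => ?_
        obtain ⟨q, hq1, hq⟩ := exists_trajProb_snoc (π := π) hξ1 hP1 τ
        have hFc (x : S × A) : F (Fin.snoc (α := fun _ => S × A) τ x) =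
            F (Fin.snoc (α := fun _ => S × A) τ x₀) := by
          refine hF _ _ fun k hk => ?_
          obtain ⟨j, rfl⟩ := Fin.exists_castSucc_eq.mpr (hk.trans (Fin.castSucc_lt_last t)).ne
          simp
        simp only [Fin.snoc_castSucc, ← Finset.sum_smul, hFc, hq, ← Finset.sum_mul,
          ← Finset.mul_sum, Fintype.sum_prod_type, hπ, hq1, mul_one]
      · intro τ τ' h
        refine hF _ _ fun k hk => ?_
        obtain ⟨j, rfl⟩ := Fin.exists_castSucc_eq.mpr (hk.trans (Fin.castSucc_lt_last t)).ne
        simpa using h j (by simpa using hk)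

/-- The likelihood-ratio identity for trajectory probabilities. -/
theorem hasGradientAt_trajProb_softmaxPolicy [Nonempty A] {d : ℕ}
    {ψ : S → A → EuclideanSpace ℝ (Fin d) → ℝ} (hdiff : ∀ s a, Differentiable ℝ (ψ s a))
    (θ : EuclideanSpace ℝ (Fin d)) {H : ℕ} (τ : Fin H → S × A) :
    HasGradientAt (fun θ' => trajProb ξ P (softmaxPolicy ψ θ') τ)
      (trajProb ξ P (softmaxPolicy ψ θ) τ •
        ∑ t, gradient (fun θ' => Real.log (softmaxPolicy ψ θ' (τ t).1 (τ t).2)) θ) θ := by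
  have hsum := HasFDerivAt.fun_sum fun t (_ : t ∈ (Finset.univ : Finset (Fin H))) =>
    ((differentiable_log_softmaxPolicy hdiff (τ t).1 (τ t).2) θ).hasFDerivAt
  have h := hsum.exp
  simp only [Real.exp_sum, Real.exp_log (softmaxPolicy_pos ψ _ _ _)] at h
  rw [hasGradientAt_iff_hasFDerivAt]
  simp only [trajProb, Finset.prod_mul_distrib, gradient, map_smul, map_sum,
    LinearIsometryEquiv.apply_symm_apply, mul_smul]
  exact h.const_mul _

end Trajectory

/-- (Truncated policy gradient theorem.) The truncated cumulative reward
`V_H(θ) = Σ_{t=0}^{H−1} γ^t Σ_τ p(τ|π_θ) r(s_t,a_t)` is differentiable in `θ`, with gradient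
equal to the expected REINFORCE estimator
`Σ_τ p(τ|π_θ) Σ_{t=0}^{H−1} γ^t r(s_t,a_t) Σ_{t'=0}^{t} ∇_θ log π_θ(a_{t'}|s_{t'})`. -/
theorem truncated_policy_gradient {S A : Type*} [Fintype S] [Fintype A]
    [Nonempty S] [Nonempty A] {d : ℕ}
    (ψ : S → A → EuclideanSpace ℝ (Fin d) → ℝ)
    (hdiff : ∀ s a, Differentiable ℝ (ψ s a))
    (ξ : S → ℝ) (hξ : ∀ s, 0 ≤ ξ s) (hξ1 : ∑ s, ξ s = 1)
    (P : S → A → S → ℝ) (hP : ∀ s a s', 0 ≤ P s a s') (hP1 : ∀ s a, ∑ s', P s a s' = 1)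
    {H : ℕ} (hH : 1 ≤ H) (γ : ℝ) (hγ0 : 0 < γ) (hγ1 : γ < 1)
    (r : S × A → ℝ) (θ : EuclideanSpace ℝ (Fin d)) :
    HasGradientAt
      (fun θ' => ∑ t : Fin H, γ ^ (t : ℕ) *
        ∑ τ : Fin H → S × A, trajProb ξ P (softmaxPolicy ψ θ') τ * r (τ t))
      (∑ τ : Fin H → S × A, trajProb ξ P (softmaxPolicy ψ θ) τ •
        ∑ t : Fin H, (γ ^ (t : ℕ) * r (τ t)) •
          ∑ t' ∈ Finset.Iic t,
            gradient (fun θ' => Real.log (softmaxPolicy ψ θ' (τ t').1 (τ t').2)) θ)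
      θ := by
  have hgrad : HasGradientAt
      (fun θ' => ∑ t : Fin H, γ ^ (t : ℕ) *
        ∑ τ : Fin H → S × A, trajProb ξ P (softmaxPolicy ψ θ') τ * r (τ t))
      (∑ t : Fin H, γ ^ (t : ℕ) • ∑ τ : Fin H → S × A, r (τ t) •
        trajProb ξ P (softmaxPolicy ψ θ) τ •
        ∑ t', gradient (fun θ' => Real.log (softmaxPolicy ψ θ' (τ t').1 (τ t').2)) θ) θ := by
    rw [hasGradientAt_iff_hasFDerivAt]
    simp only [map_sum, map_smul]
    refine HasFDerivAt.fun_sum fun t _ => HasFDerivAt.const_mul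
      (HasFDerivAt.fun_sum fun τ _ => HasFDerivAt.mul_const ?_ _) _
    simpa using (hasGradientAt_trajProb_softmaxPolicy hdiff θ τ).hasFDerivAt
  convert hgrad using 1
  simp only [Finset.smul_sum (s := (Finset.univ : Finset (Fin H)))]
  rw [Finset.sum_comm]
  refine Finset.sum_congr rfl fun t _ => ?_
  simp only [Finset.smul_sum, smul_smul]
  refine Finset.sum_comm.trans (Eq.trans ?_ Finset.sum_comm)
  refine (Finset.sum_congr rfl fun t' _ => ?_).trans
    (Finset.sum_subset (Finset.subset_univ (Finset.Iic t)) fun t' _ ht' => ?_)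
  · exact Finset.sum_congr rfl fun τ _ => by congr 1; ring
  have ht : t < t' := by simpa using ht'
  rw [← sum_trajProb_mul_smul_eq_zero hξ1 hP1 (sum_softmaxPolicy ψ θ)
    (g := fun x => gradient (fun θ' => Real.log (softmaxPolicy ψ θ' x.1 x.2)) θ)
    (sum_softmaxPolicy_smul_gradient_log hdiff θ) t' (F := fun τ => γ ^ (t : ℕ) * r (τ t))
    fun τ τ' h => by simp only [h t ht]]
  exact Finset.sum_congr rfl fun τ _ => by congr 1; ring
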